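/- arXiv:math/0408229 — 3 statements merged into one kernel-verified Lean document; each statement's English description precedes it below -/
import Mathlib

section
/- Let k ≥ 1 be an integer and let T be a smooth function on a dilation-invariant open set U ⊆ ℝ^N which is homogeneous of degree k − n/2. Then there exist smooth functions S, g, h on U such that S is homogeneous of degree k − n/2, T = S + Q·h on U, and ΔS = Q^{k−1}·g on U. (This is the flat scalar case of the paper's proposition on harmonic extension: every homogeneous field of weight k − n/2 can be modified by an O(Q) term so that its Laplacian vanishes to order k − 1 in Q along the cone.) -/
noncomputable section

open scoped BigOperators

/-- The `i`-th partial derivative of a function on `ℝ^N`. -/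
def pderiv' {N : ℕ} (i : Fin N) (f : (Fin N → ℝ) → ℝ) : (Fin N → ℝ) → ℝ :=
  fun x => fderiv ℝ f x (Pi.single i 1)

/-- The flat pseudo-Laplacian `Δf = ∑ i, εᵢ ∂²f/∂xᵢ²` with signs `ε`. -/
def lapE {N : ℕ} (ε : Fin N → ℝ) (f : (Fin N → ℝ) → ℝ) : (Fin N → ℝ) → ℝ :=
  fun x => ∑ i, ε i * pderiv' i (pderiv' i f) x

/-- The Euler operator `(Ef)(x) = ∑ i, xᵢ ∂f/∂xᵢ (x)`. -/
def eulerOp {N : ℕ} (f : (Fin N → ℝ) → ℝ) : (Fin N → ℝ) → ℝ :=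
  fun x => ∑ i, x i * pderiv' i f x

/-- The quadratic form `Q(x) = ∑ i, εᵢ xᵢ²`. -/
def Qform {N : ℕ} (ε : Fin N → ℝ) : (Fin N → ℝ) → ℝ :=
  fun x => ∑ i, ε i * (x i) ^ 2

/-- An open set `U ⊆ ℝ^N` is dilation-invariant if `t • x ∈ U` for `x ∈ U`, `t > 0`. -/
def DilationInvariant {N : ℕ} (U : Set (Fin N → ℝ)) : Prop :=
  ∀ x ∈ U, ∀ t : ℝ, 0 < t → t • x ∈ U

/-- `f` is homogeneous of degree `w` on `U`: `f(t • x) = t^w f(x)` for `x ∈ U`, `t > 0`. -/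
def HomogeneousOn {N : ℕ} (f : (Fin N → ℝ) → ℝ) (w : ℝ) (U : Set (Fin N → ℝ)) : Prop :=
  ∀ x ∈ U, ∀ t : ℝ, 0 < t → f (t • x) = t ^ w * f x


section helpers

variable {N : ℕ} {U : Set (Fin N → ℝ)} {f g : (Fin N → ℝ) → ℝ} {ε : Fin N → ℝ}

lemma sm_diffAt (hU : IsOpen U) (hf : ContDiffOn ℝ (⊤ : ℕ∞) f U) {x : Fin N → ℝ} (hx : x ∈ U) :
    DifferentiableAt ℝ f x :=
  (hf.contDiffAt (hU.mem_nhds hx)).differentiableAt (by simp)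

lemma sm_pderiv (hU : IsOpen U) (hf : ContDiffOn ℝ (⊤ : ℕ∞) f U) (i : Fin N) :
    ContDiffOn ℝ (⊤ : ℕ∞) (pderiv' i f) U := by
  have h := hf.fderiv_of_isOpen hU (m := ((⊤ : ℕ∞) : WithTop ℕ∞)) (by simp)
  exact h.clm_apply contDiffOn_const

lemma sm_lap (hU : IsOpen U) (hf : ContDiffOn ℝ (⊤ : ℕ∞) f U) :
    ContDiffOn ℝ (⊤ : ℕ∞) (lapE ε f) U := by
  unfold lapE
  exact ContDiffOn.sum fun i _ => contDiffOn_const.mul (sm_pderiv hU (sm_pderiv hU hf i) i)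

lemma sm_Q : ContDiffOn ℝ (⊤ : ℕ∞) (Qform ε) U := by
  unfold Qform
  fun_prop

lemma pd_congr (hU : IsOpen U) (h : ∀ x ∈ U, f x = g x) (i : Fin N) :
    ∀ x ∈ U, pderiv' i f x = pderiv' i g x := by
  intro x hx
  have : f =ᶠ[nhds x] g := Filter.eventually_of_mem (hU.mem_nhds hx) h
  simp only [pderiv', this.fderiv_eq]

lemma pd_add (i : Fin N) {x : Fin N → ℝ} (hf : DifferentiableAt ℝ f x)
    (hg : DifferentiableAt ℝ g x) :
    pderiv' i (fun y => f y + g y) x = pderiv' i f x + pderiv' i g x := by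
  simp only [pderiv', fderiv_fun_add hf hg, add_apply]

lemma pd_mul (i : Fin N) {x : Fin N → ℝ} (hf : DifferentiableAt ℝ f x)
    (hg : DifferentiableAt ℝ g x) :
    pderiv' i (fun y => f y * g y) x = f x * pderiv' i g x + g x * pderiv' i f x := by
  simp [pderiv', fderiv_fun_mul hf hg]

lemma pd_const_mul (c : ℝ) (i : Fin N) {x : Fin N → ℝ} (hf : DifferentiableAt ℝ f x) :
    pderiv' i (fun y => c * f y) x = c * pderiv' i f x := by
  simp [pderiv', fderiv_const_mul hf]

lemma pd_coord (i : Fin N) (x : Fin N → ℝ) : pderiv' i (fun y => y i) x = 1 := by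
  have : HasFDerivAt (fun y : Fin N → ℝ => y i) (ContinuousLinearMap.proj (R := ℝ) i) x :=
    hasFDerivAt_apply i x
  simp [pderiv', this.fderiv]

lemma pd_Q (i : Fin N) (x : Fin N → ℝ) : pderiv' i (Qform ε) x = 2 * ε i * x i := by
  have h : HasFDerivAt (Qform ε)
      (∑ j, (ε j • ((2 * x j) • (ContinuousLinearMap.proj (R := ℝ) j :
        (Fin N → ℝ) →L[ℝ] ℝ)))) x := by
    unfold Qform
    refine HasFDerivAt.fun_sum fun j _ => ?_
    have h1 : HasFDerivAt (fun y : Fin N → ℝ => y j) (ContinuousLinearMap.proj (R := ℝ) j) x :=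
      hasFDerivAt_apply j x
    have := (h1.pow 2).const_mul (ε j)
    simpa using this
  simp only [pderiv', h.fderiv]
  simp [Pi.single_apply]
  ring

lemma lap_add_const_mul (hU : IsOpen U) (hf : ContDiffOn ℝ (⊤ : ℕ∞) f U)
    (hg : ContDiffOn ℝ (⊤ : ℕ∞) g U) (c : ℝ) :
    ∀ x ∈ U, lapE ε (fun y => f y + c * g y) x = lapE ε f x + c * lapE ε g x := by
  intro x hx
  simp only [lapE, Finset.mul_sum, ← Finset.sum_add_distrib]
  refine Finset.sum_congr rfl fun i _ => ?_
  have h1 : ∀ y ∈ U, pderiv' i (fun y => f y + c * g y) y =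
      (fun y => pderiv' i f y + c * pderiv' i g y) y := by
    intro y hy
    have hg' := sm_diffAt hU hg hy
    rw [pd_add i (sm_diffAt hU hf hy) (hg'.const_mul c), pd_const_mul c i hg']
  have hg' := sm_diffAt hU (sm_pderiv hU hg i) hx
  rw [pd_congr hU h1 i x hx, pd_add i (sm_diffAt hU (sm_pderiv hU hf i) hx) (hg'.const_mul c),
    pd_const_mul c i hg']
  ring

lemma lap_Q_mul (hε : ∀ i, ε i = 1 ∨ ε i = -1) (hU : IsOpen U)
    (hf : ContDiffOn ℝ (⊤ : ℕ∞) f U) :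
    ∀ x ∈ U, lapE ε (fun y => Qform ε y * f y) x =
      Qform ε x * lapE ε f x + 2 * N * f x + 4 * eulerOp f x := by
  intro x hx
  have hN : (2 * N * f x : ℝ) = ∑ i : Fin N, 2 * f x := by simp; ring
  rw [hN]
  simp only [lapE, eulerOp, Finset.mul_sum, ← Finset.sum_add_distrib]
  refine Finset.sum_congr rfl fun i _ => ?_
  have hQ : ∀ y ∈ U, DifferentiableAt ℝ (Qform ε) y := fun y hy => sm_diffAt hU sm_Q hy
  have h1 : ∀ y ∈ U, pderiv' i (fun y => Qform ε y * f y) y =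
      (fun y => Qform ε y * pderiv' i f y + (2 * ε i) * (y i * f y)) y := by
    intro y hy
    rw [pd_mul i (hQ y hy) (sm_diffAt hU hf hy), pd_Q]
    ring
  have hfx := sm_diffAt hU hf hx
  have hp := sm_diffAt hU (sm_pderiv hU hf i) hx
  have hc : DifferentiableAt ℝ (fun y : Fin N → ℝ => y i) x := by fun_prop
  have hcf : DifferentiableAt ℝ (fun y : Fin N → ℝ => y i * f y) x := hc.mul hfx
  have hQp : DifferentiableAt ℝ (fun y : Fin N → ℝ => Qform ε y * pderiv' i f y) x :=
    (hQ x hx).mul hp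
  rw [pd_congr hU h1 i x hx, pd_add i hQp (hcf.const_mul _), pd_const_mul _ i hcf,
    pd_mul i (hQ x hx) hp, pd_mul i hc hfx, pd_Q, pd_coord]
  have : ε i * ε i = 1 := by rcases hε i with h | h <;> simp [h]
  linear_combination (4 * x i * pderiv' i f x + 2 * f x) * this

lemma euler_hom (hU : IsOpen U) (hf : ContDiffOn ℝ (⊤ : ℕ∞) f U) {w : ℝ}
    (hw : HomogeneousOn f w U) : ∀ x ∈ U, eulerOp f x = w * f x := by
  intro x hx
  have h1 : HasDerivAt (fun t : ℝ => t • x) x 1 := by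
    simpa using (hasDerivAt_id (1 : ℝ)).smul_const x
  have hfx : HasFDerivAt f (fderiv ℝ f x) ((1 : ℝ) • x) := by
    rw [one_smul]; exact (sm_diffAt hU hf hx).hasFDerivAt
  have h2 : HasDerivAt (fun t : ℝ => f (t • x)) (fderiv ℝ f x x) 1 :=
    hfx.comp_hasDerivAt (1 : ℝ) h1
  have h3 : HasDerivAt (fun t : ℝ => t ^ w * f x) (w * f x) 1 := by
    have := (Real.hasDerivAt_rpow_const (x := 1) (p := w) (Or.inl one_ne_zero)).mul_const (f x)
    simpa using this
  have h4 : (fun t : ℝ => f (t • x)) =ᶠ[nhds 1] (fun t : ℝ => t ^ w * f x) :=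
    Filter.eventually_of_mem (Ioi_mem_nhds one_pos) fun t ht => hw x hx t ht
  have h5 := h2.unique (h3.congr_of_eventuallyEq h4)
  rw [← h5]
  have h6 : x = ∑ i, x i • (Pi.single i 1 : Fin N → ℝ) := by
    ext j
    simp [Finset.sum_apply, Pi.single_apply]
  have h7 := congrArg (fderiv ℝ f x) h6
  rw [h7]
  simp only [map_sum, map_smul, smul_eq_mul, eulerOp, pderiv']

lemma pd_hom (hU : IsOpen U) (hd : DilationInvariant U) (hf : ContDiffOn ℝ (⊤ : ℕ∞) f U) {w : ℝ}
    (hw : HomogeneousOn f w U) (i : Fin N) : HomogeneousOn (pderiv' i f) (w - 1) U := by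
  intro x hx t ht
  have h0 : HasFDerivAt (fun y : Fin N → ℝ => t • y)
      (t • ContinuousLinearMap.id ℝ (Fin N → ℝ)) x := (hasFDerivAt_id x).const_smul t
  have h1 : HasFDerivAt (fun y => f (t • y)) _ x :=
    ((sm_diffAt hU hf (hd x hx t ht)).hasFDerivAt).comp x h0
  have h2 : HasFDerivAt (fun y => t ^ w * f y) _ x :=
    (sm_diffAt hU hf hx).hasFDerivAt.const_mul (t ^ w)
  have h4 : (fun y => f (t • y)) =ᶠ[nhds x] (fun y => t ^ w * f y) :=
    Filter.eventually_of_mem (hU.mem_nhds hx) fun y hy => hw y hy t ht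
  have h5 := congrArg (fun L => L (Pi.single i 1)) (h1.unique (h2.congr_of_eventuallyEq h4))
  have h6 : t * pderiv' i f (t • x) = t ^ w * pderiv' i f x := by
    simpa [pderiv'] using h5
  rw [Real.rpow_sub_one ht.ne']
  field_simp
  linarith

lemma lap_hom (hU : IsOpen U) (hd : DilationInvariant U) (hf : ContDiffOn ℝ (⊤ : ℕ∞) f U) {w : ℝ}
    (hw : HomogeneousOn f w U) : HomogeneousOn (lapE ε f) (w - 2) U := by
  intro x hx t ht
  simp only [lapE, Finset.mul_sum]
  refine Finset.sum_congr rfl fun i _ => ?_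
  rw [pd_hom hU hd (sm_pderiv hU hf i) (pd_hom hU hd hf hw i) i x hx t ht,
    show w - 1 - 1 = w - 2 by ring]
  ring

lemma Q_hom (t : ℝ) (x : Fin N → ℝ) : Qform ε (t • x) = t ^ 2 * Qform ε x := by
  simp only [Qform, Finset.mul_sum, Pi.smul_apply, smul_eq_mul]
  exact Finset.sum_congr rfl fun i _ => by ring

lemma Qpow_hom {v : ℝ} (hf : HomogeneousOn f v U) (j : ℕ) :
    HomogeneousOn (fun y => Qform ε y ^ j * f y) (v + 2 * j) U := by
  intro x hx t ht
  have : t ^ (v + 2 * j : ℝ) = t ^ v * (t ^ 2) ^ j := by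
    rw [Real.rpow_add ht, ← pow_mul, ← Real.rpow_natCast]
    push_cast
    rfl
  simp only [Q_hom, hf x hx t ht, this]
  ring

lemma sm_Qpow_mul (hf : ContDiffOn ℝ (⊤ : ℕ∞) f U) (j : ℕ) :
    ContDiffOn ℝ (⊤ : ℕ∞) (fun y => Qform ε y ^ j * f y) U :=
  (sm_Q.pow j).mul hf

lemma lap_Qpow (hε : ∀ i, ε i = 1 ∨ ε i = -1) (hU : IsOpen U)
    (hf : ContDiffOn ℝ (⊤ : ℕ∞) f U) {v : ℝ} (hv : HomogeneousOn f v U) (j : ℕ) :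
    ∀ x ∈ U, lapE ε (fun y => Qform ε y ^ (j + 1) * f y) x =
      Qform ε x ^ (j + 1) * lapE ε f x
        + 2 * (j + 1) * (N + 2 * j + 2 * v) * (Qform ε x ^ j * f x) := by
  induction j with
  | zero =>
    intro x hx
    simp only [zero_add, pow_one]
    rw [lap_Q_mul hε hU hf x hx, euler_hom hU hf hv x hx]
    push_cast
    ring
  | succ j ih =>
    intro x hx
    have e : (fun y => Qform ε y ^ (j + 1 + 1) * f y) =
        fun y => Qform ε y * (fun y => Qform ε y ^ (j + 1) * f y) y := by
      ext y; ring
    have hs := sm_Qpow_mul (ε := ε) hf (j + 1)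
    rw [e, lap_Q_mul hε hU hs x hx, euler_hom hU hs (Qpow_hom hv (j + 1)) x hx, ih x hx]
    push_cast
    ring

end helpers

/-- Flat scalar harmonic extension: every `T` homogeneous of degree `k − n/2` can be
modified by an `O(Q)` term so that its Laplacian is `O(Q^(k−1))`. -/
theorem harmonic_extension (n : ℕ) (hn : 1 ≤ n) (ε : Fin (n + 2) → ℝ)
    (hε : ∀ i, ε i = 1 ∨ ε i = -1)
    (U : Set (Fin (n + 2) → ℝ)) (hU : IsOpen U) (hUdil : DilationInvariant U)
    (k : ℕ) (hk : 1 ≤ k)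
    (T : (Fin (n + 2) → ℝ) → ℝ) (hT : ContDiffOn ℝ (⊤ : ℕ∞) T U)
    (hThom : HomogeneousOn T ((k : ℝ) - (n : ℝ) / 2) U) :
    ∃ S g h : (Fin (n + 2) → ℝ) → ℝ,
      ContDiffOn ℝ (⊤ : ℕ∞) S U ∧ ContDiffOn ℝ (⊤ : ℕ∞) g U ∧ ContDiffOn ℝ (⊤ : ℕ∞) h U ∧
      HomogeneousOn S ((k : ℝ) - (n : ℝ) / 2) U ∧
      (∀ x ∈ U, T x = S x + Qform ε x * h x) ∧
      (∀ x ∈ U, lapE ε S x = (Qform ε x) ^ (k - 1) * g x) := by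
  have key : ∀ m : ℕ, m + 1 ≤ k → ∃ S g h : (Fin (n + 2) → ℝ) → ℝ,
      ContDiffOn ℝ (⊤ : ℕ∞) S U ∧ ContDiffOn ℝ (⊤ : ℕ∞) g U ∧ ContDiffOn ℝ (⊤ : ℕ∞) h U ∧
      HomogeneousOn S ((k : ℝ) - (n : ℝ) / 2) U ∧
      HomogeneousOn g ((k : ℝ) - (n : ℝ) / 2 - 2 - 2 * m) U ∧
      (∀ x ∈ U, T x = S x + Qform ε x * h x) ∧
      (∀ x ∈ U, lapE ε S x = (Qform ε x) ^ m * g x) := by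
    intro m
    induction m with
    | zero =>
      intro _
      refine ⟨T, lapE ε T, fun _ => 0, hT, sm_lap hU hT, contDiffOn_const, hThom, ?_, ?_, ?_⟩
      · simpa using lap_hom hU hUdil hT hThom
      · simp
      · simp
    | succ m ih =>
      intro hm
      obtain ⟨S, g, h, hS, hg, hh, hSw, hgw, hTS, hL⟩ := ih (by omega)
      have hkm : (m : ℝ) + 1 + 1 ≤ k := by exact_mod_cast hm
      obtain ⟨C, hC⟩ : ∃ C : ℝ, C = 2 * (m + 1) * (2 * (k - 1 - m)) := ⟨_, rfl⟩
      have hC0 : C ≠ 0 := by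
        rw [hC]
        have : (0 : ℝ) < k - 1 - m := by linarith
        positivity
      have hs := sm_Qpow_mul (ε := ε) hg (m + 1)
      refine ⟨fun y => S y + (-C⁻¹) * (Qform ε y ^ (m + 1) * g y),
        fun y => (-C⁻¹) * lapE ε g y, fun y => h y + C⁻¹ * (Qform ε y ^ m * g y),
        hS.add (contDiffOn_const.mul hs), contDiffOn_const.mul (sm_lap hU hg),
        hh.add (contDiffOn_const.mul (sm_Qpow_mul hg m)), ?_, ?_, ?_, ?_⟩
      · intro x hx t ht
        have h1 := Qpow_hom (ε := ε) hgw (m + 1) x hx t ht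
        rw [show (k : ℝ) - (n : ℝ) / 2 - 2 - 2 * m + 2 * ((m + 1 : ℕ) : ℝ) = k - (n : ℝ) / 2 by
          push_cast; ring] at h1
        simp only [] at h1 ⊢
        rw [h1, hSw x hx t ht]
        ring
      · intro x hx t ht
        have h1 := lap_hom (ε := ε) hU hUdil hg hgw x hx t ht
        rw [show (k : ℝ) - (n : ℝ) / 2 - 2 - 2 * m - 2 =
          k - (n : ℝ) / 2 - 2 - 2 * ((m + 1 : ℕ) : ℝ) by push_cast; ring] at h1
        simp only []
        rw [h1]
        ring
      · intro x hx
        rw [hTS x hx]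
        ring
      · intro x hx
        rw [lap_add_const_mul hU hS hs _ x hx, lap_Qpow hε hU hg hgw m x hx, hL x hx]
        have : 2 * ((m : ℝ) + 1) * (((n + 2 : ℕ) : ℝ) + 2 * m +
            2 * ((k : ℝ) - (n : ℝ) / 2 - 2 - 2 * m)) = C := by
          rw [hC]; push_cast; ring
        rw [this]
        field_simp
        ring
  obtain ⟨S, g, h, hS, hg, hh, hSw, -, hTS, hL⟩ := key (k - 1) (by omega)
  exact ⟨S, g, h, hS, hg, hh, hSw, hTS, hL⟩
end
end

section
/- For every smooth function f on an open set U ⊆ ℝ^N and every index 1 ≤ i ≤ N, one has Dᵢ(Q·f) = Q·Dᵢf + 4Q·∂ᵢf on U. In particular, if f = Q·h with h smooth then Dᵢf = Q·(smooth), so the tractor-D operator acts tangentially along the null cone {Q = 0}. (Flat-model form of the paper's identity D̃(QV) = Q·D̃V + 4Q·∇V.) -/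
noncomputable section

open scoped BigOperators

/-- The `i`-th component of the flat tractor-D operator:
`Dᵢ f = ∂ᵢ((n + 2E − 2) f) − εᵢ xᵢ Δf`. -/
def Dop {N : ℕ} (n : ℕ) (ε : Fin N → ℝ) (i : Fin N) (f : (Fin N → ℝ) → ℝ) :
    (Fin N → ℝ) → ℝ :=
  fun x => pderiv' i (fun y => (n : ℝ) * f y + 2 * eulerOp f y - 2 * f y) x
    - ε i * x i * lapE ε f x

lemma aux_pd_mul {N : ℕ} (i : Fin N) {f g : (Fin N → ℝ) → ℝ} {x : Fin N → ℝ}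
    (hf : DifferentiableAt ℝ f x) (hg : DifferentiableAt ℝ g x) :
    pderiv' i (fun y => f y * g y) x = pderiv' i f x * g x + f x * pderiv' i g x := by
  unfold pderiv'
  rw [fderiv_fun_mul hf hg]
  simp
  ring

lemma aux_pd_add {N : ℕ} (i : Fin N) {f g : (Fin N → ℝ) → ℝ} {x : Fin N → ℝ}
    (hf : DifferentiableAt ℝ f x) (hg : DifferentiableAt ℝ g x) :
    pderiv' i (fun y => f y + g y) x = pderiv' i f x + pderiv' i g x := by
  unfold pderiv'
  rw [fderiv_fun_add hf hg]
  simp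

lemma aux_pd_const_mul {N : ℕ} (i : Fin N) {f : (Fin N → ℝ) → ℝ} {x : Fin N → ℝ} (c : ℝ)
    (hf : DifferentiableAt ℝ f x) :
    pderiv' i (fun y => c * f y) x = c * pderiv' i f x := by
  unfold pderiv'
  rw [fderiv_const_mul hf]
  simp

lemma aux_pd_congr {N : ℕ} (i : Fin N) {f g : (Fin N → ℝ) → ℝ} {U : Set (Fin N → ℝ)}
    (hU : IsOpen U) (h : ∀ y ∈ U, f y = g y) : ∀ x ∈ U, pderiv' i f x = pderiv' i g x := by
  intro x hx
  unfold pderiv'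
  rw [Filter.EventuallyEq.fderiv_eq (Filter.eventually_of_mem (hU.mem_nhds hx) h)]

lemma aux_pd_smooth {N : ℕ} (i : Fin N) {f : (Fin N → ℝ) → ℝ} {U : Set (Fin N → ℝ)}
    (hU : IsOpen U) (h : ContDiffOn ℝ (⊤ : ℕ∞) f U) :
    ContDiffOn ℝ (⊤ : ℕ∞) (pderiv' i f) U := by
  unfold pderiv'
  exact (h.fderiv_of_isOpen hU (m := ((⊤ : ℕ∞) : WithTop ℕ∞)) (by simp)).clm_apply
    contDiffOn_const

lemma aux_diff {N : ℕ} {f : (Fin N → ℝ) → ℝ} {U : Set (Fin N → ℝ)}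
    (hU : IsOpen U) (h : ContDiffOn ℝ (⊤ : ℕ∞) f U) {x : Fin N → ℝ} (hx : x ∈ U) :
    DifferentiableAt ℝ f x :=
  (h.contDiffAt (hU.mem_nhds hx)).differentiableAt (by simp)

lemma aux_coord {N : ℕ} (j : Fin N) : ContDiff ℝ (⊤ : ℕ∞) (fun y : Fin N → ℝ => y j) := by
  fun_prop

lemma aux_Q_smooth {N : ℕ} (ε : Fin N → ℝ) : ContDiff ℝ (⊤ : ℕ∞) (Qform ε) := by
  unfold Qform
  fun_prop

lemma aux_pd_coord {N : ℕ} (i j : Fin N) (x : Fin N → ℝ) :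
    pderiv' i (fun y : Fin N → ℝ => y j) x = if j = i then 1 else 0 := by
  unfold pderiv'
  have h : HasFDerivAt (fun y : Fin N → ℝ => y j)
    (ContinuousLinearMap.proj (R := ℝ) (φ := fun _ : Fin N => ℝ) j) x :=
    (ContinuousLinearMap.proj (R := ℝ) (φ := fun _ : Fin N => ℝ) j).hasFDerivAt
  rw [h.fderiv]
  simp [Pi.single_apply]

lemma aux_pd_Q {N : ℕ} (ε : Fin N → ℝ) (i : Fin N) (x : Fin N → ℝ) :
    pderiv' i (Qform ε) x = 2 * ε i * x i := by
  have hs : pderiv' i (Qform ε) x = ∑ j, pderiv' i (fun y => ε j * (y j * y j)) x := by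
    unfold pderiv' Qform
    rw [fderiv_fun_sum (fun j _ => by fun_prop)]
    simp [sq]
  rw [hs]
  have h2 : ∀ j, pderiv' i (fun y : Fin N → ℝ => ε j * (y j * y j)) x
      = if j = i then 2 * ε i * x i else 0 := by
    intro j
    rw [aux_pd_const_mul i _ (by fun_prop), aux_pd_mul i (by fun_prop) (by fun_prop),
      aux_pd_coord]
    split_ifs with h
    · subst h; ring
    · simp
  simp [h2]

lemma aux_euler_smooth {N : ℕ} {f : (Fin N → ℝ) → ℝ} {U : Set (Fin N → ℝ)}
    (hU : IsOpen U) (h : ContDiffOn ℝ (⊤ : ℕ∞) f U) :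
    ContDiffOn ℝ (⊤ : ℕ∞) (eulerOp f) U := by
  unfold eulerOp
  exact ContDiffOn.sum fun j _ => (aux_coord j).contDiffOn.mul (aux_pd_smooth j hU h)

lemma aux_G_smooth {N : ℕ} (n : ℕ) {f : (Fin N → ℝ) → ℝ} {U : Set (Fin N → ℝ)}
    (hU : IsOpen U) (h : ContDiffOn ℝ (⊤ : ℕ∞) f U) :
    ContDiffOn ℝ (⊤ : ℕ∞) (fun y => (n : ℝ) * f y + 2 * eulerOp f y - 2 * f y) U :=
  ((contDiffOn_const.mul h).add (contDiffOn_const.mul (aux_euler_smooth hU h))).sub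
    (contDiffOn_const.mul h)

lemma aux_D_smooth {N : ℕ} (n : ℕ) (ε : Fin N → ℝ) (i : Fin N) {f : (Fin N → ℝ) → ℝ}
    {U : Set (Fin N → ℝ)} (hU : IsOpen U) (h : ContDiffOn ℝ (⊤ : ℕ∞) f U) :
    ContDiffOn ℝ (⊤ : ℕ∞) (Dop n ε i f) U := by
  unfold Dop lapE
  refine (aux_pd_smooth i hU (aux_G_smooth n hU h)).sub ?_
  refine (contDiffOn_const.mul (aux_coord i).contDiffOn).mul ?_
  exact ContDiffOn.sum fun j _ =>
    contDiffOn_const.mul (aux_pd_smooth j hU (aux_pd_smooth j hU h))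

lemma aux_D_congr {N : ℕ} (n : ℕ) (ε : Fin N → ℝ) (i : Fin N) {f g : (Fin N → ℝ) → ℝ}
    {U : Set (Fin N → ℝ)} (hU : IsOpen U) (h : ∀ y ∈ U, f y = g y) :
    ∀ x ∈ U, Dop n ε i f x = Dop n ε i g x := by
  intro x hx
  unfold Dop
  congr 1
  · refine aux_pd_congr i hU (fun y hy => ?_) x hx
    have : eulerOp f y = eulerOp g y := by
      unfold eulerOp
      exact Finset.sum_congr rfl fun j _ => by rw [aux_pd_congr j hU h y hy]
    rw [this, h y hy]
  · congr 1
    unfold lapE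
    exact Finset.sum_congr rfl fun j _ => by
      rw [aux_pd_congr j hU (aux_pd_congr j hU h) x hx]

lemma aux_pd_Qmul {N : ℕ} (ε : Fin N → ℝ) (i : Fin N) {f : (Fin N → ℝ) → ℝ}
    {U : Set (Fin N → ℝ)} (hU : IsOpen U) (h : ContDiffOn ℝ (⊤ : ℕ∞) f U) :
    ∀ x ∈ U, pderiv' i (fun y => Qform ε y * f y) x
      = (2 * ε i) * (x i * f x) + Qform ε x * pderiv' i f x := by
  intro x hx
  rw [aux_pd_mul i ((aux_Q_smooth ε).differentiable (by simp) x) (aux_diff hU h hx), aux_pd_Q]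
  ring

lemma aux_euler_Qmul {N : ℕ} (ε : Fin N → ℝ) {f : (Fin N → ℝ) → ℝ}
    {U : Set (Fin N → ℝ)} (hU : IsOpen U) (h : ContDiffOn ℝ (⊤ : ℕ∞) f U) :
    ∀ x ∈ U, eulerOp (fun y => Qform ε y * f y) x
      = Qform ε x * (eulerOp f x + 2 * f x) := by
  intro x hx
  have h1 : eulerOp (fun y => Qform ε y * f y) x
      = ∑ j, ((ε j * x j ^ 2) * (2 * f x) + Qform ε x * (x j * pderiv' j f x)) := by
    unfold eulerOp
    refine Finset.sum_congr rfl fun j _ => ?_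
    rw [aux_pd_Qmul ε j hU h x hx]
    ring
  rw [h1, Finset.sum_add_distrib, ← Finset.sum_mul, ← Finset.mul_sum]
  change Qform ε x * (2 * f x) + Qform ε x * eulerOp f x = _
  ring

lemma aux_lap_Qmul {N : ℕ} (ε : Fin N → ℝ) (hε : ∀ i, ε i = 1 ∨ ε i = -1)
    {f : (Fin N → ℝ) → ℝ}
    {U : Set (Fin N → ℝ)} (hU : IsOpen U) (h : ContDiffOn ℝ (⊤ : ℕ∞) f U) :
    ∀ x ∈ U, lapE ε (fun y => Qform ε y * f y) x
      = Qform ε x * lapE ε f x + 4 * eulerOp f x + 2 * N * f x := by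
  intro x hx
  have h1 : lapE ε (fun y => Qform ε y * f y) x
      = ∑ j, (Qform ε x * (ε j * pderiv' j (pderiv' j f) x)
          + 4 * (x j * pderiv' j f x) + 2 * f x) := by
    unfold lapE
    refine Finset.sum_congr rfl fun j _ => ?_
    have hfd := aux_diff hU h hx
    have hpd := aux_diff hU (aux_pd_smooth j hU h) hx
    have hQ : DifferentiableAt ℝ (Qform ε) x := (aux_Q_smooth ε).differentiable (by simp) x
    have hc : DifferentiableAt ℝ (fun y : Fin N → ℝ => y j) x := by fun_prop
    have hsq : ε j * ε j = 1 := by rcases hε j with e | e <;> rw [e] <;> norm_num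
    rw [aux_pd_congr j hU (aux_pd_Qmul ε j hU h) x hx,
      aux_pd_add j ((hc.fun_mul hfd).const_mul _) (hQ.fun_mul hpd),
      aux_pd_const_mul j _ (hc.fun_mul hfd), aux_pd_mul j hc hfd, aux_pd_coord,
      aux_pd_mul j hQ hpd, aux_pd_Q, if_pos rfl]
    linear_combination (2 * f x + 4 * x j * pderiv' j f x) * hsq
  rw [h1, Finset.sum_add_distrib, Finset.sum_add_distrib, ← Finset.mul_sum, ← Finset.mul_sum]
  simp only [Finset.sum_const, Finset.card_univ, Fintype.card_fin, nsmul_eq_mul]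
  change Qform ε x * lapE ε f x + 4 * eulerOp f x + _ = _
  ring

lemma aux_main (n : ℕ) (ε : Fin (n + 2) → ℝ)
    (hε : ∀ i, ε i = 1 ∨ ε i = -1)
    (U : Set (Fin (n + 2) → ℝ)) (hU : IsOpen U)
    (f : (Fin (n + 2) → ℝ) → ℝ) (hf : ContDiffOn ℝ (⊤ : ℕ∞) f U) :
    ∀ i : Fin (n + 2), ∀ x ∈ U,
      Dop n ε i (fun y => Qform ε y * f y) x
        = Qform ε x * Dop n ε i f x + 4 * Qform ε x * pderiv' i f x := by
  intro i x hx
  have hG := aux_G_smooth n hU hf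
  have hG4 : ContDiffOn ℝ (⊤ : ℕ∞)
      (fun y => ((n : ℝ) * f y + 2 * eulerOp f y - 2 * f y) + 4 * f y) U :=
    hG.add (contDiffOn_const.mul hf)
  have hfd := aux_diff hU hf hx
  have e1 : ∀ y ∈ U, (n : ℝ) * (Qform ε y * f y) + 2 * eulerOp (fun y => Qform ε y * f y) y
      - 2 * (Qform ε y * f y)
      = Qform ε y * (((n : ℝ) * f y + 2 * eulerOp f y - 2 * f y) + 4 * f y) := by
    intro y hy
    rw [aux_euler_Qmul ε hU hf y hy]
    ring
  unfold Dop
  rw [aux_pd_congr i hU e1 x hx, aux_pd_Qmul ε i hU hG4 x hx,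
    aux_pd_add i (aux_diff hU hG hx) (hfd.const_mul 4), aux_pd_const_mul i 4 hfd,
    aux_lap_Qmul ε hε hU hf x hx]
  push_cast
  ring

/-- Flat-model identity `D(Q·f) = Q·Df + 4Q·∇f`; in particular the tractor-D
operator acts tangentially along the null cone `{Q = 0}`. -/
theorem Dop_tangential (n : ℕ) (hn : 1 ≤ n) (ε : Fin (n + 2) → ℝ)
    (hε : ∀ i, ε i = 1 ∨ ε i = -1)
    (U : Set (Fin (n + 2) → ℝ)) (hU : IsOpen U)
    (f : (Fin (n + 2) → ℝ) → ℝ) (hf : ContDiffOn ℝ (⊤ : ℕ∞) f U) :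
    (∀ i : Fin (n + 2), ∀ x ∈ U,
      Dop n ε i (fun y => Qform ε y * f y) x
        = Qform ε x * Dop n ε i f x + 4 * Qform ε x * pderiv' i f x)
    ∧ ∀ h : (Fin (n + 2) → ℝ) → ℝ, ContDiffOn ℝ (⊤ : ℕ∞) h U →
        (∀ x ∈ U, f x = Qform ε x * h x) →
        ∀ i : Fin (n + 2), ∃ g : (Fin (n + 2) → ℝ) → ℝ,
          ContDiffOn ℝ (⊤ : ℕ∞) g U ∧ ∀ x ∈ U, Dop n ε i f x = Qform ε x * g x := by
  refine ⟨aux_main n ε hε U hU f hf, ?_⟩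
  intro h hh hfh i
  refine ⟨fun x => Dop n ε i h x + 4 * pderiv' i h x,
    (aux_D_smooth n ε i hU hh).add (contDiffOn_const.mul (aux_pd_smooth i hU hh)), ?_⟩
  intro x hx
  rw [aux_D_congr n ε i hU hfh x hx, aux_main n ε hε U hU h hh i x hx]
  ring
end
end

section
/- Let U be a smooth function on a dilation-invariant open set Ω ⊆ ℝ^N, homogeneous of degree 2 − n/2. Then Σ_{i=1}^{N} εᵢ · Dᵢ( Δ( Dᵢ U )) = (n − 4)·Δ² U + Q·Δ³ U on Ω. In particular, at every point x ∈ Ω with Q(x) = 0 one has Σ_{i} εᵢ Dᵢ(Δ(DᵢU))(x) = (n−4)·Δ²U(x). (This is the exact m = 2 instance, in the flat model, of the paper's formula D^{A}□D_{A}U = (n−4)·□₂U relating the contracted tractor-D composition to the square of the Laplacian.) -/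
noncomputable section

open scoped BigOperators

section helpers

variable {N : ℕ} {Ω : Set (Fin N → ℝ)} {f g : (Fin N → ℝ) → ℝ}

lemma diffAt_of (hΩ : IsOpen Ω) (hf : ContDiffOn ℝ (⊤ : ℕ∞) f Ω) {x : Fin N → ℝ} (hx : x ∈ Ω) :
    DifferentiableAt ℝ f x :=
  (hf.contDiffAt (hΩ.mem_nhds hx)).differentiableAt (by simp)

lemma pd_smooth (hΩ : IsOpen Ω) (i : Fin N) (hf : ContDiffOn ℝ (⊤ : ℕ∞) f Ω) :
    ContDiffOn ℝ (⊤ : ℕ∞) (pderiv' i f) Ω := by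
  have h := hf.fderiv_of_isOpen (m := (⊤ : ℕ∞)) hΩ (by simp)
  exact h.clm_apply contDiffOn_const

lemma pd_congr_s14 (hΩ : IsOpen Ω) (i : Fin N) (h : Set.EqOn f g Ω) :
    Set.EqOn (pderiv' i f) (pderiv' i g) Ω := by
  intro x hx
  have : f =ᶠ[nhds x] g := Filter.eventuallyEq_of_mem (hΩ.mem_nhds hx) h
  simp only [pderiv', this.fderiv_eq]

lemma lap_congr (hΩ : IsOpen Ω) (ε : Fin N → ℝ) (h : Set.EqOn f g Ω) :
    Set.EqOn (lapE ε f) (lapE ε g) Ω := by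
  intro x hx
  simp only [lapE]
  refine Finset.sum_congr rfl fun i _ => ?_
  rw [pd_congr_s14 hΩ i (pd_congr_s14 hΩ i h) hx]

lemma lap_smooth (hΩ : IsOpen Ω) (ε : Fin N → ℝ) (hf : ContDiffOn ℝ (⊤ : ℕ∞) f Ω) :
    ContDiffOn ℝ (⊤ : ℕ∞) (lapE ε f) Ω := by
  unfold lapE
  exact ContDiffOn.sum fun i _ => contDiffOn_const.mul (pd_smooth hΩ i (pd_smooth hΩ i hf))

lemma coord_smooth (i : Fin N) : ContDiffOn ℝ (⊤ : ℕ∞) (fun y : Fin N → ℝ => y i) Ω :=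
  (contDiff_apply ℝ ℝ i).contDiffOn

lemma euler_smooth (hΩ : IsOpen Ω) (hf : ContDiffOn ℝ (⊤ : ℕ∞) f Ω) :
    ContDiffOn ℝ (⊤ : ℕ∞) (eulerOp f) Ω := by
  unfold eulerOp
  exact ContDiffOn.sum fun i _ => (coord_smooth i).mul (pd_smooth hΩ i hf)

lemma pd_comm (hΩ : IsOpen Ω) (i j : Fin N) (hf : ContDiffOn ℝ (⊤ : ℕ∞) f Ω) :
    Set.EqOn (pderiv' i (pderiv' j f)) (pderiv' j (pderiv' i f)) Ω := by
  intro x hx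
  have hc : ContDiffAt ℝ (⊤ : ℕ∞) f x := hf.contDiffAt (hΩ.mem_nhds hx)
  have hs : IsSymmSndFDerivAt ℝ f x := hc.isSymmSndFDerivAt (by simp; norm_cast)
  have hd : DifferentiableAt ℝ (fderiv ℝ f) x :=
    (hc.fderiv_right (m := 1) (by norm_cast)).differentiableAt (by simp)
  have key : ∀ a b : Fin N, pderiv' a (pderiv' b f) x
      = fderiv ℝ (fderiv ℝ f) x (Pi.single a 1) (Pi.single b 1) := by
    intro a b
    have : pderiv' b f = fun y => fderiv ℝ f y (Pi.single b 1) := rfl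
    rw [this]
    simp only [pderiv']
    rw [fderiv_clm_apply hd (differentiableAt_const _)]
    simp
  rw [key, key]
  exact hs _ _

lemma pd_lin (hΩ : IsOpen Ω) (i : Fin N) (a b : ℝ) (hf : ContDiffOn ℝ (⊤ : ℕ∞) f Ω)
    (hg : ContDiffOn ℝ (⊤ : ℕ∞) g Ω) :
    Set.EqOn (pderiv' i (fun y => a * f y + b * g y))
      (fun y => a * pderiv' i f y + b * pderiv' i g y) Ω := by
  intro x hx
  have h1 := (diffAt_of hΩ hf hx).hasFDerivAt
  have h2 := (diffAt_of hΩ hg hx).hasFDerivAt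
  have := ((h1.const_mul a).add (h2.const_mul b)).fderiv
  simp only [pderiv']
  erw [this]
  simp

lemma pd_smul (hΩ : IsOpen Ω) (i : Fin N) (a : ℝ) (hf : ContDiffOn ℝ (⊤ : ℕ∞) f Ω) :
    Set.EqOn (pderiv' i (fun y => a * f y)) (fun y => a * pderiv' i f y) Ω := by
  intro x hx
  have := pd_lin hΩ i a 0 hf hf hx
  simpa using this

lemma pd_sum (hΩ : IsOpen Ω) (i : Fin N) (F : Fin N → (Fin N → ℝ) → ℝ)
    (hF : ∀ j, ContDiffOn ℝ (⊤ : ℕ∞) (F j) Ω) :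
    Set.EqOn (pderiv' i (fun y => ∑ j, F j y)) (fun y => ∑ j, pderiv' i (F j) y) Ω := by
  intro x hx
  simp only [pderiv']
  rw [fderiv_fun_sum fun j _ => diffAt_of hΩ (hF j) hx]
  simp

lemma pd_coord_mul (hΩ : IsOpen Ω) (i j : Fin N) (hf : ContDiffOn ℝ (⊤ : ℕ∞) f Ω) :
    Set.EqOn (pderiv' i (fun y => y j * f y))
      (fun y => (if i = j then f y else 0) + y j * pderiv' i f y) Ω := by
  intro x hx
  have h1 := (diffAt_of hΩ hf hx).hasFDerivAt
  have h0 : HasFDerivAt (fun y : Fin N → ℝ => y j)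
    (ContinuousLinearMap.proj (R := ℝ) (φ := fun _ : Fin N => ℝ) j) x := hasFDerivAt_apply j x
  have := (h0.mul h1).fderiv
  simp only [pderiv']
  erw [this]
  by_cases h : i = j
  · subst h; simp; ring
  · simp [h, Pi.single_apply, Ne.symm h, eq_comm]

lemma lap_lin (hΩ : IsOpen Ω) (ε : Fin N → ℝ) (a b : ℝ) (hf : ContDiffOn ℝ (⊤ : ℕ∞) f Ω)
    (hg : ContDiffOn ℝ (⊤ : ℕ∞) g Ω) :
    Set.EqOn (lapE ε (fun y => a * f y + b * g y))
      (fun y => a * lapE ε f y + b * lapE ε g y) Ω := by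
  intro x hx
  simp only [lapE, Finset.mul_sum, ← Finset.sum_add_distrib]
  refine Finset.sum_congr rfl fun i _ => ?_
  rw [pd_congr_s14 hΩ i (pd_lin hΩ i a b hf hg) hx,
    pd_lin hΩ i a b (pd_smooth hΩ i hf) (pd_smooth hΩ i hg) hx]
  ring

lemma lap_smul (hΩ : IsOpen Ω) (ε : Fin N → ℝ) (a : ℝ) (hf : ContDiffOn ℝ (⊤ : ℕ∞) f Ω) :
    Set.EqOn (lapE ε (fun y => a * f y)) (fun y => a * lapE ε f y) Ω := by
  intro x hx
  have := lap_lin hΩ ε a 0 hf hf hx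
  simpa using this

lemma lap_pd (hΩ : IsOpen Ω) (ε : Fin N → ℝ) (i : Fin N) (hf : ContDiffOn ℝ (⊤ : ℕ∞) f Ω) :
    Set.EqOn (lapE ε (pderiv' i f)) (pderiv' i (lapE ε f)) Ω := by
  intro x hx
  have h2 : ∀ j, ContDiffOn ℝ (⊤ : ℕ∞) (pderiv' j (pderiv' j f)) Ω :=
    fun j => pd_smooth hΩ j (pd_smooth hΩ j hf)
  have e := pd_sum hΩ i (fun j y => ε j * pderiv' j (pderiv' j f) y)
    (fun j => contDiffOn_const.mul (h2 j)) hx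
  change _ = pderiv' i (fun y => ∑ j, ε j * pderiv' j (pderiv' j f) y) x
  rw [e]
  simp only [lapE]
  refine Finset.sum_congr rfl fun j _ => ?_
  rw [pd_smul hΩ i (ε j) (h2 j) hx, pd_congr_s14 hΩ j (pd_comm hΩ j i hf) hx,
    pd_comm hΩ j i (pd_smooth hΩ j hf) hx]

lemma lap_coord_mul (hΩ : IsOpen Ω) (ε : Fin N → ℝ) (i : Fin N)
    (hf : ContDiffOn ℝ (⊤ : ℕ∞) f Ω) :
    Set.EqOn (lapE ε (fun y => y i * f y))
      (fun y => y i * lapE ε f y + 2 * ε i * pderiv' i f y) Ω := by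
  intro x hx
  have key : ∀ j, pderiv' j (pderiv' j (fun y => y i * f y)) x
      = x i * pderiv' j (pderiv' j f) x + (if j = i then 2 * pderiv' i f x else 0) := by
    intro j
    rw [pd_congr_s14 hΩ j (pd_coord_mul hΩ j i hf) hx]
    by_cases h : j = i
    · subst h
      have h1 := pd_lin hΩ j 1 1 hf ((coord_smooth j).mul (pd_smooth hΩ j hf)) hx
      have h2 := pd_coord_mul hΩ j j (pd_smooth hΩ j hf) hx
      simp only [one_mul, if_true] at h1 h2 ⊢
      rw [h1, h2]; ring
    · have h2 := pd_coord_mul hΩ j i (pd_smooth hΩ j hf) hx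
      simp only [h, if_false, zero_add, add_zero] at h2 ⊢
      exact h2
  simp only [lapE, key, mul_add, Finset.sum_add_distrib, Finset.mul_sum]
  congr 1
  · exact Finset.sum_congr rfl fun j _ => by ring
  · simp; ring

/-- Infinitesimal homogeneity. -/
def Hom' (Ω : Set (Fin N → ℝ)) (w : ℝ) (f : (Fin N → ℝ) → ℝ) : Prop :=
  Set.EqOn (eulerOp f) (fun y => w * f y) Ω

lemma hom_of (hΩ : IsOpen Ω) {w : ℝ} (hf : ContDiffOn ℝ (⊤ : ℕ∞) f Ω)
    (h : HomogeneousOn f w Ω) : Hom' Ω w f := by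
  intro x hx
  have hd := (diffAt_of hΩ hf hx).hasFDerivAt
  have hl : HasDerivAt (fun t : ℝ => t • x) x 1 := by
    simpa using (hasDerivAt_id (1 : ℝ)).smul_const x
  have h1 : HasDerivAt (fun t : ℝ => f (t • x)) (fderiv ℝ f x x) 1 := by
    have hd' : HasFDerivAt f (fderiv ℝ f x) ((1 : ℝ) • x) := by simpa using hd
    exact hd'.comp_hasDerivAt 1 hl
  have h2 : HasDerivAt (fun t : ℝ => t ^ w * f x) (w * f x) 1 := by
    simpa using (Real.hasDerivAt_rpow_const (x := 1) (p := w) (Or.inl one_ne_zero)).mul_const (f x)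
  have h3 : (fun t : ℝ => f (t • x)) =ᶠ[nhds 1] fun t : ℝ => t ^ w * f x := by
    filter_upwards [lt_mem_nhds (zero_lt_one : (0 : ℝ) < 1)] with t ht using h x hx t ht
  have h4 := (h2.congr_of_eventuallyEq h3).unique h1
  simp only [eulerOp, pderiv']
  rw [h4]
  conv_rhs => rw [← Finset.univ_sum_single x, map_sum]
  refine Finset.sum_congr rfl fun i _ => ?_
  rw [show (Pi.single i (x i) : Fin N → ℝ) = x i • Pi.single i 1 by
    rw [← Pi.single_smul]; simp, map_smul, smul_eq_mul, Finset.univ_sum_single x]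

lemma hom_pd (hΩ : IsOpen Ω) {w : ℝ} (i : Fin N) (hf : ContDiffOn ℝ (⊤ : ℕ∞) f Ω)
    (h : Hom' Ω w f) : Hom' Ω (w - 1) (pderiv' i f) := by
  intro x hx
  have h1 := pd_congr_s14 hΩ i h hx
  rw [pd_smul hΩ i w hf hx] at h1
  have h2 := pd_sum hΩ i (fun j y => y j * pderiv' j f y)
    (fun j => (coord_smooth j).mul (pd_smooth hΩ j hf)) hx
  change pderiv' i (eulerOp f) x = _ at h2
  have h3 : ∀ j, pderiv' i (fun y => y j * pderiv' j f y) x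
      = (if i = j then pderiv' j f x else 0) + x j * pderiv' j (pderiv' i f) x := by
    intro j
    rw [pd_coord_mul hΩ i j (pd_smooth hΩ j hf) hx, pd_comm hΩ j i hf hx]
  simp only [h3, Finset.sum_add_distrib] at h2
  rw [h1] at h2
  simp only [Finset.sum_ite_eq, Finset.mem_univ, if_true] at h2
  simp only [eulerOp]
  linarith

lemma hom_coord_mul (hΩ : IsOpen Ω) {w : ℝ} (i : Fin N) (hf : ContDiffOn ℝ (⊤ : ℕ∞) f Ω)
    (h : Hom' Ω w f) : Hom' Ω (w + 1) (fun y => y i * f y) := by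
  intro x hx
  have h1 := h hx
  simp only [eulerOp] at h1 ⊢
  have h3 : ∀ j, x j * pderiv' j (fun y => y i * f y) x
      = (if j = i then x j * f x else 0) + x i * (x j * pderiv' j f x) := by
    intro j
    rw [pd_coord_mul hΩ j i hf hx]
    split_ifs <;> ring
  simp only [h3, Finset.sum_add_distrib, ← Finset.mul_sum, h1]
  simp; ring

lemma hom_smul (hΩ : IsOpen Ω) {w : ℝ} (a : ℝ) (hf : ContDiffOn ℝ (⊤ : ℕ∞) f Ω)
    (h : Hom' Ω w f) : Hom' Ω w (fun y => a * f y) := by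
  intro x hx
  have h1 := h hx
  simp only [eulerOp] at h1 ⊢
  have h3 : ∀ j, x j * pderiv' j (fun y => a * f y) x = a * (x j * pderiv' j f x) := by
    intro j
    rw [pd_smul hΩ j a hf hx]
    ring
  simp only [h3, ← Finset.mul_sum, h1]
  ring

lemma hom_lap (hΩ : IsOpen Ω) {w : ℝ} (ε : Fin N → ℝ) (hf : ContDiffOn ℝ (⊤ : ℕ∞) f Ω)
    (h : Hom' Ω w f) : Hom' Ω (w - 2) (lapE ε f) := by
  intro x hx
  have h2 : ∀ j, ContDiffOn ℝ (⊤ : ℕ∞) (fun y => ε j * pderiv' j (pderiv' j f) y) Ω :=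
    fun j => contDiffOn_const.mul (pd_smooth hΩ j (pd_smooth hΩ j hf))
  have e : ∀ i, pderiv' i (lapE ε f) x
      = ∑ j, pderiv' i (fun y => ε j * pderiv' j (pderiv' j f) y) x :=
    fun i => pd_sum hΩ i (fun j y => ε j * pderiv' j (pderiv' j f) y) h2 hx
  have hh : ∀ j, ∑ i, x i * pderiv' i (fun y => ε j * pderiv' j (pderiv' j f) y) x
      = (w - 1 - 1) * (ε j * pderiv' j (pderiv' j f) x) := fun j =>
    hom_smul hΩ (ε j) (pd_smooth hΩ j (pd_smooth hΩ j hf))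
      (hom_pd hΩ j (pd_smooth hΩ j hf) (hom_pd hΩ j hf h)) hx
  simp only [eulerOp, e, Finset.mul_sum]
  rw [Finset.sum_comm]
  simp only [hh, ← Finset.mul_sum, lapE]
  ring

lemma Dop_hom (hΩ : IsOpen Ω) {w : ℝ} (n : ℕ) (ε : Fin N → ℝ) (i : Fin N)
    (hf : ContDiffOn ℝ (⊤ : ℕ∞) f Ω) (h : Hom' Ω w f) :
    Set.EqOn (Dop n ε i f)
      (fun y => (n + 2 * w - 2) * pderiv' i f y + (-ε i) * (y i * lapE ε f y)) Ω := by
  intro x hx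
  have h1 : Set.EqOn (fun y => (n : ℝ) * f y + 2 * eulerOp f y - 2 * f y)
      (fun y => (n + 2 * w - 2) * f y) Ω := by
    intro y hy
    have := h hy
    simp only at this ⊢
    rw [this]; ring
  simp only [Dop]
  rw [pd_congr_s14 hΩ i h1 hx, pd_smul hΩ i _ hf hx]
  ring

lemma Dop_congr (hΩ : IsOpen Ω) (n : ℕ) (ε : Fin N → ℝ) (i : Fin N) (h : Set.EqOn f g Ω) :
    Set.EqOn (Dop n ε i f) (Dop n ε i g) Ω := by
  intro x hx
  simp only [Dop]
  rw [lap_congr hΩ ε h hx]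
  congr 1
  refine pd_congr_s14 hΩ i (fun y hy => ?_) hx
  have : eulerOp f y = eulerOp g y :=
    Finset.sum_congr rfl fun j _ => by rw [pd_congr_s14 hΩ j h hy]
  simp only [this, h hy]

end helpers

/-- Exact flat `m = 2` case of `D^A □ D_A U = (n − 4)·□₂ U`:
`∑ i, εᵢ Dᵢ(Δ(Dᵢ U)) = (n − 4)·Δ²U + Q·Δ³U` on functions homogeneous of degree
`2 − n/2`; in particular the left-hand side equals `(n − 4)·Δ²U` on the cone `{Q = 0}`. -/
theorem Dop_lap_Dop_identity (n : ℕ) (hn : 1 ≤ n) (ε : Fin (n + 2) → ℝ)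
    (hε : ∀ i, ε i = 1 ∨ ε i = -1)
    (Ω : Set (Fin (n + 2) → ℝ)) (hΩ : IsOpen Ω) (hΩdil : DilationInvariant Ω)
    (U : (Fin (n + 2) → ℝ) → ℝ) (hU : ContDiffOn ℝ (⊤ : ℕ∞) U Ω)
    (hUhom : HomogeneousOn U (2 - (n : ℝ) / 2) Ω) :
    (∀ x ∈ Ω,
      (∑ i : Fin (n + 2), ε i * Dop n ε i (lapE ε (Dop n ε i U)) x)
        = ((n : ℝ) - 4) * (lapE ε)^[2] U x + Qform ε x * (lapE ε)^[3] U x)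
    ∧ ∀ x ∈ Ω, Qform ε x = 0 →
        (∑ i : Fin (n + 2), ε i * Dop n ε i (lapE ε (Dop n ε i U)) x)
          = ((n : ℝ) - 4) * (lapE ε)^[2] U x := by
  have main : ∀ x ∈ Ω,
      (∑ i : Fin (n + 2), ε i * Dop n ε i (lapE ε (Dop n ε i U)) x)
        = ((n : ℝ) - 4) * (lapE ε)^[2] U x + Qform ε x * (lapE ε)^[3] U x := by
    have hsq : ∀ i, ε i * ε i = 1 := fun i => by rcases hε i with h | h <;> simp [h]
    have H0 := hom_of hΩ hU hUhom
    have sV := lap_smooth hΩ ε hU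
    have sW := lap_smooth hΩ ε sV
    have HW := hom_lap hΩ ε sV (hom_lap hΩ ε hU H0)
    simp only [Function.iterate_succ, Function.iterate_zero, Function.comp, id]
    set W := lapE ε (lapE ε U) with hW
    intro x hx
    have step1 : ∀ i, Set.EqOn (lapE ε (Dop n ε i U)) (fun y => (-ε i) * (y i * W y)) Ω := by
      intro i y hy
      rw [lap_congr hΩ ε (Dop_hom hΩ n ε i hU H0) hy,
        lap_lin hΩ ε _ _ (pd_smooth hΩ i hU) ((coord_smooth i).mul sV) hy]
      simp only
      rw [lap_coord_mul hΩ ε i sV hy, lap_pd hΩ ε i hU hy]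
      simp only [← hW]
      linear_combination (-2 * pderiv' i (lapE ε U) y) * hsq i
    have step2 : ∀ i, ε i * Dop n ε i (lapE ε (Dop n ε i U)) x
        = 4 * W x + 6 * (x i * pderiv' i W x) + (ε i * x i ^ 2) * lapE ε W x := by
      intro i
      have sx := (coord_smooth (Ω := Ω) i).mul sW
      rw [Dop_congr hΩ n ε i (step1 i) hx,
        Dop_hom hΩ n ε i (contDiffOn_const.mul sx)
          (hom_smul hΩ (-ε i) sx (hom_coord_mul hΩ i sW HW)) hx]
      simp only
      rw [pd_smul hΩ i (-ε i) sx hx, lap_smul hΩ ε (-ε i) sx hx]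
      simp only
      rw [pd_coord_mul hΩ i i sW hx, lap_coord_mul hΩ ε i sW hx]
      simp only [if_true]
      linear_combination (4 * W x + 4 * x i * pderiv' i W x + ε i * x i ^ 2 * lapE ε W x
        + 2 * (ε i * ε i + 1) * x i * pderiv' i W x) * hsq i
    have hE := HW hx
    simp only [eulerOp] at hE
    simp only [step2, Finset.sum_add_distrib, ← Finset.mul_sum, ← Finset.sum_mul, hE, Qform]
    simp
    ring
  refine ⟨main, fun x hx hQ => ?_⟩
  rw [main x hx, hQ]; ring
end
end
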